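/- arXiv:2008.09283 — 5 statements merged into one kernel-verified Lean document; each statement's English description precedes it below -/
import Mathlib

section
/- Suppose θ ∈ (0,1), λ ∈ (0,1], R > 0, and α > R. Then the transparent-case-3 firm payoff strictly exceeds the opaque-case-4 firm payoff if and only if β > β₂, where β₂ = R − αR(1−λ)/((α−R)λ + R(1−λ)). Hence in region C2 the firm strictly prefers the transparent algorithm exactly when β > β₂. -/
/-- In region C2 the firm strictly prefers the transparent algorithm iff β > β₂. -/
theorem firm_transparent_iff_beta_gt_beta2
    (θ lam R α β : ℝ)
    (hθ0 : 0 < θ) (hθ1 : θ < 1)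
    (hlam0 : 0 < lam) (hlam1 : lam ≤ 1)
    (hR : 0 < R) (hα : α > R) :
    (θ * (α + β) + (1 - θ) * β - R
        > θ * (α + β - R) * (1 - R * (1 - θ) * (1 - lam) / ((α - R) * θ * lam)))
      ↔ β > R - α * R * (1 - lam) / ((α - R) * lam + R * (1 - lam)) := by
  have hαR : 0 < α - R := sub_pos.mpr hα
  have hden : 0 < (α - R) * lam + R * (1 - lam) :=
    add_pos_of_pos_of_nonneg (mul_pos hαR hlam0) (mul_nonneg hR.le (sub_nonneg.mpr hlam1))
  have hcoef : 0 < (1 - θ) * ((α - R) * lam + R * (1 - lam)) / ((α - R) * lam) :=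
    div_pos (mul_pos (sub_pos.mpr hθ1) hden) (mul_pos hαR hlam0)
  have hdiff : (θ * (α + β) + (1 - θ) * β - R)
      - θ * (α + β - R) * (1 - R * (1 - θ) * (1 - lam) / ((α - R) * θ * lam))
      = (1 - θ) * ((α - R) * lam + R * (1 - lam)) / ((α - R) * lam)
        * (β - (R - α * R * (1 - lam) / ((α - R) * lam + R * (1 - lam)))) := by
    have hαR' := hαR.ne'
    have hcancel : ((α - R) * lam + R * (1 - lam))
        * (β - (R - α * R * (1 - lam) / ((α - R) * lam + R * (1 - lam))))
        = ((α - R) * lam + R * (1 - lam)) * (β - R) + α * R * (1 - lam) := by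
      rw [← sub_add, mul_add, mul_div_cancel₀ _ hden.ne']
    rw [div_mul_eq_mul_div, mul_assoc (1 - θ), hcancel]
    field_simp
    ring
  rw [gt_iff_lt, gt_iff_lt, ← sub_pos, hdiff, mul_pos_iff_of_pos_left hcoef, sub_pos]
end

section
/- Suppose θ ∈ (0,1), λ ∈ [1/2,1], λ < 1, and R > 0. Then the transparent-case-3 firm payoff strictly exceeds the opaque-case-5 firm payoff if and only if β > β₃, where β₃ = (λθα − θα − 2λθR + θR + λR)/(λ − 2θλ + θ). Hence in region C3 the firm strictly prefers the transparent algorithm exactly when β > β₃. -/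
/-- In region C3 the firm strictly prefers the transparent algorithm iff β > β₃. -/
theorem firm_transparent_iff_beta_gt_beta3
    (θ lam R α β : ℝ)
    (hθ0 : 0 < θ) (hθ1 : θ < 1)
    (hlam0 : 1/2 ≤ lam) (hlam1 : lam ≤ 1) (hlam2 : lam < 1)
    (hR : 0 < R) :
    (θ * (α + β) + (1 - θ) * β - R
        > (2 * lam - 1) / lam * (θ * (α + β - R)))
      ↔ β > (lam * θ * α - θ * α - 2 * lam * θ * R + θ * R + lam * R)
              / (lam - 2 * θ * lam + θ) := by
  have hlam : 0 < lam := by linarith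
  have hD : 0 < lam - 2 * θ * lam + θ := by
    nlinarith [mul_pos hlam (sub_pos.2 hθ1), mul_pos hθ0 (sub_pos.2 hlam2)]
  rw [gt_iff_lt, gt_iff_lt, div_lt_iff₀ hD, div_mul_eq_mul_div, div_lt_iff₀ hlam]
  constructor <;> intro h <;> linarith
end

section
/- Suppose θ ∈ (0,1), λ ∈ [1/2,1], R > 0, β > 0, and α > (θλ + (1−θ)(1−λ))R/(θλ). Then the transparent-case-2 firm payoff strictly exceeds the opaque-case-1 firm payoff: θ(α+β−R) > λθα − (λθ + (1−λ)(1−θ))R. Hence in region C4 the firm strictly prefers the transparent algorithm regardless of the value of β. -/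
/-- In region C4 the firm strictly prefers the transparent algorithm
regardless of the value of β: Π_{T2} > Π_{O1}. -/
theorem firm_prefers_transparent_in_C4
    (θ lam R α β : ℝ)
    (hθ0 : 0 < θ) (hθ1 : θ < 1)
    (hlam0 : 1/2 ≤ lam) (hlam1 : lam ≤ 1)
    (hR : 0 < R) (hβ : 0 < β)
    (hα : α > (θ * lam + (1 - θ) * (1 - lam)) * R / (θ * lam)) :
    θ * (α + β - R) > lam * θ * α - (lam * θ + (1 - lam) * (1 - θ)) * R := by
  have hlam : 0 < lam := by linarith
  have hθlam : 0 < θ * lam := mul_pos hθ0 hlam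
  have hrest : 0 ≤ (1 - θ) * (1 - lam) * R :=
    mul_nonneg (mul_nonneg (by linarith) (by linarith)) hR.le
  have hαR : R < α := by
    refine lt_of_le_of_lt ?_ hα
    rw [le_div_iff₀ hθlam]
    linarith
  have hgain : 0 ≤ (1 - lam) * θ * (α - R) :=
    mul_nonneg (mul_nonneg (by linarith) hθ0.le) (by linarith)
  have hθβ : 0 < θ * β := mul_pos hθ0 hβ
  linarith
end

section
/- Suppose θ ∈ (0,1), λ ∈ (1/2,1), R > 0, and α satisfies (θλ + (1−θ)(1−λ))R/(θλ) < α < R/θ. Then the three thresholds are strictly ordered: β₁ < β₂ < β₃, where β₁ = λθ(α−R) − (1−λ)(1−θ)R + R − θα, β₂ = R − αR(1−λ)/((α−R)λ + R(1−λ)), and β₃ = (λθα − θα − 2λθR + θR + λR)/(λ − 2θλ + θ). -/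
/-- Under Assumption 2 the three thresholds are strictly ordered: β₁ < β₂ < β₃. -/
theorem beta_thresholds_ordered
    (θ lam R α : ℝ)
    (hθ0 : 0 < θ) (hθ1 : θ < 1)
    (hlam0 : 1/2 < lam) (hlam1 : lam < 1)
    (hR : 0 < R)
    (hα_lo : (θ * lam + (1 - θ) * (1 - lam)) * R / (θ * lam) < α)
    (hα_hi : α < R / θ) :
    lam * θ * (α - R) - (1 - lam) * (1 - θ) * R + R - θ * α
      < R - α * R * (1 - lam) / ((α - R) * lam + R * (1 - lam))
    ∧ R - α * R * (1 - lam) / ((α - R) * lam + R * (1 - lam))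
      < (lam * θ * α - θ * α - 2 * lam * θ * R + θ * R + lam * R)
          / (lam - 2 * θ * lam + θ) := by
  have hl : 0 < lam := by linarith
  have hu : 0 < 1 - lam := by linarith
  have ht : 0 < 1 - θ := by linarith
  have hlo : (θ * lam + (1 - θ) * (1 - lam)) * R < α * (θ * lam) :=
    (div_lt_iff₀ (by positivity)).1 hα_lo
  have hhi : α * θ < R := (lt_div_iff₀ hθ0).1 hα_hi
  have hRα : R < α := by
    have h : 0 < (1 - θ) * (1 - lam) * R := by positivity
    have h' : R * (θ * lam) < α * (θ * lam) := by linarith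
    exact lt_of_mul_lt_mul_right h' (by positivity)
  have hα : 0 < α := hR.trans hRα
  have hD : 0 < (α - R) * lam + R * (1 - lam) :=
    add_pos (mul_pos (sub_pos.2 hRα) hl) (mul_pos hR hu)
  have hE : 0 < lam - 2 * θ * lam + θ := by
    linarith [mul_pos hl ht, mul_pos hθ0 hu]
  constructor
  · have key : α * R * (1 - lam) / ((α - R) * lam + R * (1 - lam))
        < θ * (1 - lam) * α + R * (θ * lam + (1 - θ) * (1 - lam)) := by
      rw [div_lt_iff₀ hD]
      have h : 0 < (1 - lam) * α + (2 * lam - 1) * R :=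
        add_pos (mul_pos hu hα) (mul_pos (by linarith) hR)
      linarith [mul_pos (sub_pos.2 hlo) h]
    linarith
  · have key : (1 - lam) * θ * α / (lam - 2 * θ * lam + θ)
        < α * R * (1 - lam) / ((α - R) * lam + R * (1 - lam)) := by
      rw [div_lt_div_iff₀ hE hD]
      linarith [mul_pos (mul_pos (mul_pos hu hα) hl) (sub_pos.2 hhi)]
    have hβ₃ : (lam * θ * α - θ * α - 2 * lam * θ * R + θ * R + lam * R)
          / (lam - 2 * θ * lam + θ)
        = R - (1 - lam) * θ * α / (lam - 2 * θ * lam + θ) := by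
      rw [eq_sub_iff_add_eq, ← add_div, div_eq_iff hE.ne']
      ring
    rw [hβ₃]
    linarith
end

section
/- Suppose θ ∈ [0,1], λ ∈ (0,1], R > 0, and C_L ≤ R. Then the agents' total payoff in the transparent scenario where all agents improve education is at least their total payoff in opaque case 5: R − θC_H − (1−θ)C_L ≥ (2Rλ − R − C_Hλ − C_Lλ + C_L)θ/λ. Hence in region C3 the agents' welfare is higher under the transparent algorithm. -/
/-- In region C3, agents' welfare is higher under the transparent algorithm:
Π^A_{T3} ≥ Π^A_{O5}. -/
theorem agents_prefer_transparent_in_C3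
    (θ lam R CH CL : ℝ)
    (hθ0 : 0 ≤ θ) (hθ1 : θ ≤ 1)
    (hlam0 : 0 < lam) (hlam1 : lam ≤ 1)
    (hR : 0 < R) (hCL : CL ≤ R) :
    R - θ * CH - (1 - θ) * CL
      ≥ (2 * R * lam - R - CH * lam - CL * lam + CL) * θ / lam := by
  rw [ge_iff_le, div_le_iff₀ hlam0]
  have hmix : 0 ≤ lam * (1 - θ) + θ * (1 - lam) :=
    add_nonneg (mul_nonneg hlam0.le (sub_nonneg.2 hθ1)) (mul_nonneg hθ0 (sub_nonneg.2 hlam1))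
  linarith [mul_nonneg (sub_nonneg.2 hCL) hmix]
end
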